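/- Let η_1 = (√5 − 1)/2 be the golden mean and let 0 < σ < η_1. Suppose r is an irrational number with 0 < r ≤ 1, B_σ(r) < +∞, and B_σ(r) ≤ B_σ(x) for every irrational x ∈ (0,1) (i.e. r is a global minimizer of B_σ). Then r = η_1. -/

import Mathlib

open Real Set MeasureTheory
open scoped ENNReal

/-- The Gauss map `A(x) = 1/x - ⌊1/x⌋`. -/
noncomputable def gaussMap (x : ℝ) : ℝ := 1 / x - (⌊1 / x⌋ : ℝ)

/-- `brjunoBeta x j = β_{j-1}(x) = ∏_{i=0}^{j-1} A^i(x)`; in particular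
`brjunoBeta x 0 = β_{-1}(x) = 1` and `β_K(x) = brjunoBeta x (K+1)`. -/
noncomputable def brjunoBeta (x : ℝ) (j : ℕ) : ℝ := ∏ i ∈ Finset.range j, gaussMap^[i] x

/-- The σ-Brjuno function `B_σ(x) = Σ_{j≥0} β_{j-1}(x) · (A^j x)^{-1/σ}`, valued in `[0,+∞]`. -/
noncomputable def brjuno (σ x : ℝ) : ℝ≥0∞ :=
  ∑' j : ℕ, ENNReal.ofReal (brjunoBeta x j * (gaussMap^[j] x) ^ (-(1 / σ)))

/-- The K-th partial sum `B_σ^{(K)}(x) = Σ_{j=0}^{K} β_{j-1}(x) · (A^j x)^{-1/σ}`. -/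
noncomputable def brjunoPartial (σ x : ℝ) (K : ℕ) : ℝ :=
  ∑ j ∈ Finset.range (K + 1), brjunoBeta x j * (gaussMap^[j] x) ^ (-(1 / σ))

/-- The fixed point `η_m = (√(m²+4) − m)/2 = [0; m, m, m, ...]` of the Gauss map. -/
noncomputable def eta (m : ℕ) : ℝ := (Real.sqrt ((m : ℝ) ^ 2 + 4) - m) / 2

/-- `b* = (σ+1)^{1+1/σ}/σ`. -/
noncomputable def bstar (σ : ℝ) : ℝ := (σ + 1) ^ (1 + 1 / σ) / σ

/-- The global lower bound `g(x) = x^{-1/σ} + b*·x`. -/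
noncomputable def gLow (σ x : ℝ) : ℝ := x ^ (-(1 / σ)) + bstar σ * x

/-- The cylinder lower bound `g_k(x) = x^{-1/σ} + x·(1/x − k)^{-1/σ} + (1 − kx)·b*`. -/
noncomputable def gCyl (σ : ℝ) (k : ℕ) (x : ℝ) : ℝ :=
  x ^ (-(1 / σ)) + x * (1 / x - (k : ℝ)) ^ (-(1 / σ)) + (1 - (k : ℝ) * x) * bstar σ
/-- The functional equation `B_σ(x) = x^{-1/σ} + x B_σ(A x)`. -/
theorem brjuno_eq_add (σ : ℝ) {x : ℝ} (hx : 0 ≤ x) :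
    brjuno σ x =
      ENNReal.ofReal (x ^ (-(1 / σ))) + ENNReal.ofReal x * brjuno σ (gaussMap x) := by
  unfold brjuno
  rw [tsum_eq_zero_add' ENNReal.summable, ← ENNReal.tsum_mul_left]
  congr 1
  · simp [brjunoBeta]
  · refine tsum_congr fun j => ?_
    rw [← ENNReal.ofReal_mul hx]
    simp only [brjunoBeta, Finset.prod_range_succ', Function.iterate_succ_apply,
      Function.iterate_zero, id]
    ring_nf

theorem gaussMap_eq_fract (x : ℝ) : gaussMap x = Int.fract (1 / x) := rfl

theorem Irrational.gaussMap {x : ℝ} (hx : Irrational x) : Irrational (gaussMap x) := by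
  have h : Irrational (1 / x) := by simpa using hx.inv
  exact h.sub_intCast _

theorem gaussMap_mem_Ioo {x : ℝ} (hx : Irrational x) : gaussMap x ∈ Set.Ioo (0 : ℝ) 1 := by
  refine ⟨lt_of_le_of_ne ?_ hx.gaussMap.ne_zero.symm, ?_⟩
  · exact Int.fract_nonneg (1 / x)
  · exact Int.fract_lt_one (1 / x)

theorem gaussMap_eq_of_half_lt {x : ℝ} (hx : 1 / 2 < x) (hx1 : x < 1) :
    gaussMap x = (1 - x) / x := by
  have h0 : 0 < x := by linarith
  have h : ⌊1 / x⌋ = 1 := by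
    rw [Int.floor_eq_iff, le_div_iff₀ h0, div_lt_iff₀ h0]
    constructor <;> push_cast <;> linarith
  rw [_root_.gaussMap, h]
  field_simp
  push_cast
  ring

theorem eta_one_eq_neg_goldenConj : eta 1 = -Real.goldenConj := by
  unfold eta Real.goldenConj
  norm_num
  ring

theorem eta_one_sq : eta 1 ^ 2 = 1 - eta 1 := by
  have := Real.goldenConj_sq
  rw [eta_one_eq_neg_goldenConj]
  linarith

theorem eta_one_mem_Ioo : eta 1 ∈ Set.Ioo (1 / 2 : ℝ) 1 := by
  have h := eta_one_sq
  have h0 : 0 < eta 1 := by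
    rw [eta_one_eq_neg_goldenConj]
    linarith [Real.goldenConj_neg]
  constructor <;> nlinarith

theorem irrational_eta_one : Irrational (eta 1) := by
  rw [eta_one_eq_neg_goldenConj]
  exact Real.goldenConj_irrational.neg

theorem gaussMap_eta_one : gaussMap (eta 1) = eta 1 := by
  obtain ⟨h1, h2⟩ := eta_one_mem_Ioo
  rw [gaussMap_eq_of_half_lt h1 h2, div_eq_iff (by linarith), ← eta_one_sq]
  ring

theorem brjuno_eta_one (σ : ℝ) :
    brjuno σ (eta 1) = ENNReal.ofReal (eta 1 ^ (-(1 / σ)) / (1 - eta 1)) := by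
  obtain ⟨h1, h2⟩ := eta_one_mem_Ioo
  have h0 : 0 < eta 1 := by linarith
  have hs := (hasSum_geometric_of_lt_one h0.le h2).mul_right (eta 1 ^ (-(1 / σ)))
  rw [div_eq_inv_mul, ← hs.tsum_eq, ENNReal.ofReal_tsum_of_nonneg (fun j => by positivity)
    hs.summable]
  refine tsum_congr fun j => ?_
  simp [brjunoBeta, Function.iterate_fixed gaussMap_eta_one]

/-- The function `x ↦ x^{-s} / (1 - x)` exceeds its value at the golden mean to the left of it. -/
theorem rpow_mul_one_sub_lt_of_lt_eta_one {s r : ℝ} (hs : 1 < s * eta 1) (hr0 : 0 < r)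
    (hr : r < eta 1) : r ^ s * (1 - r) < eta 1 ^ s * (1 - eta 1) := by
  obtain ⟨h1, h2⟩ := eta_one_mem_Ioo
  have hsq := eta_one_sq
  set g := eta 1
  have h0 : 0 < g := by linarith
  have h1r : 0 < 1 - r := by linarith
  have h1g : 0 < 1 - g := by linarith
  have hs0 : 0 < s := by
    by_contra! h
    nlinarith
  rw [← Real.log_lt_log_iff (by positivity) (by positivity),
    Real.log_mul (by positivity) h1r.ne', Real.log_mul (by positivity) h1g.ne',
    Real.log_rpow hr0, Real.log_rpow h0]
  have ha := Real.log_le_sub_one_of_pos (div_pos hr0 h0)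
  have hb := Real.log_le_sub_one_of_pos (div_pos h1r h1g)
  rw [Real.log_div hr0.ne' h0.ne'] at ha
  rw [Real.log_div h1r.ne' h1g.ne', ← hsq] at hb
  have ha' := mul_le_mul_of_nonneg_left ha hs0.le
  have key : s * (r / g - 1) + ((1 - r) / g ^ 2 - 1) = (s * g - 1) * (r - g) / g ^ 2 := by
    field_simp
    linear_combination -hsq
  have hneg : (s * g - 1) * (r - g) / g ^ 2 < 0 :=
    div_neg_of_neg_of_pos (mul_neg_of_pos_of_neg (by linarith) (by linarith)) (by positivity)
  rw [← hsq]
  linarith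

/-- The function `x ↦ x^{-s-1} + (x / (1 - x))^s` exceeds its value at the golden mean to the
right of it. -/
theorem lt_rpow_add_rpow_of_eta_one_lt {s r : ℝ} (hs : 1 < s * eta 1) (hr : eta 1 < r)
    (hr1 : r < 1) :
    eta 1 ^ (-s) / (1 - eta 1) < r ^ (-s) / r + ((1 - r) / r) ^ (-s) := by
  obtain ⟨h1, h2⟩ := eta_one_mem_Ioo
  have hsq := eta_one_sq
  set g := eta 1
  have h0 : 0 < g := by linarith
  have hr0 : 0 < r := by linarith
  have h1r : 0 < 1 - r := by linarith
  have hs1 : 1 ≤ s := by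
    by_contra! h
    nlinarith
  set t := r / g with ht
  have ht1 : 1 < t := (one_lt_div h0).2 hr
  have ht0 : 0 < t := by linarith
  have hrt : r = g * t := by rw [ht]; field_simp
  set u := g * r / (1 - r) with hu
  have hu0 : 0 < u := by positivity
  have hru : (1 - r) / r = g * u⁻¹ := by rw [hu]; field_simp
  have hA : 1 - (s + 1) * (t - 1) ≤ t ^ (-s) / t := by
    rw [← Real.rpow_sub_one ht0.ne', Real.rpow_def_of_pos ht0]
    have := Real.add_one_le_exp (Real.log t * (-s - 1))
    have := Real.log_le_sub_one_of_pos ht0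
    nlinarith
  have hB : 1 + s * (u - 1) ≤ u ^ s := by
    simpa using one_add_mul_self_le_rpow_one_add (s := u - 1) (by linarith) hs1
  have hu1 : (t - 1) / g ^ 2 ≤ u - 1 := by
    have : u - 1 = (t - 1) / (1 - r) := by
      rw [hu, ht]
      field_simp
      linear_combination r * hsq
    rw [this, hsq]
    exact div_le_div_of_nonneg_left (by linarith) h1r (by linarith)
  have e1 : r ^ (-s) / r = g ^ (-s) * (t ^ (-s) / t / g) := by
    rw [hrt, Real.mul_rpow h0.le ht0.le]
    field_simp
  have e2 : ((1 - r) / r) ^ (-s) = g ^ (-s) * u ^ s := by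
    rw [hru, Real.mul_rpow h0.le (by positivity), Real.inv_rpow hu0.le, Real.rpow_neg hu0.le,
      inv_inv]
  rw [e1, e2, ← mul_add, div_eq_mul_inv]
  refine mul_lt_mul_of_pos_left ?_ (by positivity)
  have hA' : (1 - (s + 1) * (t - 1)) / g ≤ t ^ (-s) / t / g := by gcongr
  have hB' := mul_le_mul_of_nonneg_left hu1 (by linarith : 0 ≤ s)
  have key : (1 - (s + 1) * (t - 1)) / g + (1 + s * ((t - 1) / g ^ 2)) - (1 - g)⁻¹ =
      (s * g - 1) * (t - 1) / g := by
    rw [← hsq]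
    field_simp
    linear_combination (1 - s * (t - 1)) * hsq
  have hpos : 0 < (s * g - 1) * (t - 1) / g :=
    div_pos (mul_pos (by linarith) (by linarith)) h0
  linarith

/-- for `0 < σ < η_1` (golden mean), any global minimizer `r ∈ (0,1]`
of `B_σ` equals `η_1 = (√5 − 1)/2`. -/
theorem brjuno_minimizer_golden (σ : ℝ) (hσ : 0 < σ) (hσ1 : σ < eta 1) (r : ℝ)
    (hr : Irrational r) (hr0 : 0 < r) (hr1 : r ≤ 1) (hfin : brjuno σ r < ⊤)
    (hmin : ∀ x : ℝ, Irrational x → x ∈ Set.Ioo (0 : ℝ) 1 → brjuno σ r ≤ brjuno σ x) :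
    r = eta 1 := by
  have hr1' : r < 1 := lt_of_le_of_ne hr1 hr.ne_one
  obtain ⟨h1, h2⟩ := eta_one_mem_Ioo
  have hg0 : 0 < eta 1 := by linarith
  have h1g : 0 < 1 - eta 1 := by linarith
  have hs : 1 < 1 / σ * eta 1 := by rwa [one_div_mul_eq_div, one_lt_div hσ]
  have hmin1 := hmin _ hr.gaussMap (gaussMap_mem_Ioo hr)
  have hmin2 := hmin _ hr.gaussMap.gaussMap (gaussMap_mem_Ioo hr.gaussMap)
  have hgold := hmin _ irrational_eta_one ⟨hg0, h2⟩
  rw [brjuno_eta_one] at hgold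
  have heq := brjuno_eq_add σ hr0.le
  obtain ⟨b, hb0, hb⟩ : ∃ b : ℝ, 0 ≤ b ∧ brjuno σ r = ENNReal.ofReal b :=
    ⟨_, ENNReal.toReal_nonneg, (ENNReal.ofReal_toReal hfin.ne).symm⟩
  have hbg : b ≤ eta 1 ^ (-(1 / σ)) / (1 - eta 1) := by
    rw [hb] at hgold
    exact (ENNReal.ofReal_le_ofReal_iff (by positivity)).1 hgold
  rcases lt_trichotomy r (eta 1) with hlt | rfl | hgt
  · exfalso
    have hle : r ^ (-(1 / σ)) + r * b ≤ b := by
      rw [← ENNReal.ofReal_le_ofReal_iff hb0, ENNReal.ofReal_add (by positivity) (by positivity),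
        ENNReal.ofReal_mul hr0.le, ← hb]
      conv_rhs => rw [heq]
      gcongr
    have h1r : 0 < 1 - r := by linarith
    have hlow : r ^ (-(1 / σ)) / (1 - r) ≤ b := by
      rw [div_le_iff₀ h1r]
      linarith
    have hkey := one_div_lt_one_div_of_lt (by positivity)
      (rpow_mul_one_sub_lt_of_lt_eta_one hs hr0 hlt)
    have hle := hlow.trans hbg
    rw [Real.rpow_neg hr0.le, Real.rpow_neg hg0.le, ← one_div, ← one_div, div_div, div_div]
      at hle
    exact hkey.not_ge hle
  · rfl
  · exfalso
    have hgm := gaussMap_eq_of_half_lt (h1.trans hgt) hr1'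
    have h1r : 0 < 1 - r := by linarith
    have hq : 0 < (1 - r) / r := by positivity
    rw [brjuno_eq_add σ (gaussMap_mem_Ioo hr).1.le] at heq
    have hle : r ^ (-(1 / σ)) + r * (((1 - r) / r) ^ (-(1 / σ)) + (1 - r) / r * b) ≤ b := by
      rw [← ENNReal.ofReal_le_ofReal_iff hb0, ENNReal.ofReal_add (by positivity) (by positivity),
        ENNReal.ofReal_mul hr0.le, ENNReal.ofReal_add (by positivity) (by positivity),
        ENNReal.ofReal_mul hq.le, ← hb, ← hgm]
      conv_rhs => rw [heq]
      gcongr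
    have hkey := lt_rpow_add_rpow_of_eta_one_lt hs hgt hr1'
    have hlow : r ^ (-(1 / σ)) / r + ((1 - r) / r) ^ (-(1 / σ)) ≤ b := by
      have e : r * (((1 - r) / r) ^ (-(1 / σ)) + (1 - r) / r * b) =
          r * ((1 - r) / r) ^ (-(1 / σ)) + (1 - r) * b := by
        field_simp
      rw [e] at hle
      rw [← le_sub_iff_add_le, div_le_iff₀ hr0]
      linarith
    linarith
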